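/- Let B be a right R-module and let X be a left R-module. Then there is a natural isomorphism Ext¹_{R^op}(B, Hom_ℤ(X, ℚ/ℤ)) ≅ Hom_ℤ(Tor₁^R(B, X), ℚ/ℤ). -/

import Mathlib

universe u

open TensorProduct CategoryTheory DirectSum

noncomputable section

/-- The submodule of relations presenting the tensor product `Q ⊗_R M` as a quotient of
`Q ⊗_ℤ M`, for a right `R`-module `Q` and a left `R`-module `M`. -/
def tensorRelations (R : Type u) [Ring R] (Q : Type u) [AddCommGroup Q] [Module Rᵐᵒᵖ Q]
    (M : Type u) [AddCommGroup M] [Module R M] : Submodule ℤ (TensorProduct ℤ Q M) :=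
  Submodule.span ℤ
    {x | ∃ (q : Q) (r : R) (m : M), x = (MulOpposite.op r • q) ⊗ₜ[ℤ] m - q ⊗ₜ[ℤ] (r • m)}

/-- The map `Q ⊗_R M → Q ⊗_R N` induced by `f` is injective, where `Q ⊗_R -` is realized
as the quotient of `Q ⊗_ℤ -` by `tensorRelations`. -/
def StaysInjective (R : Type u) [Ring R] (Q : Type u) [AddCommGroup Q] [Module Rᵐᵒᵖ Q]
    {M N : Type u} [AddCommGroup M] [Module R M] [AddCommGroup N] [Module R N]
    (f : M →ₗ[R] N) : Prop :=
  ∀ z : TensorProduct ℤ Q M,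
    LinearMap.lTensor Q f.toAddMonoidHom.toIntLinearMap z ∈ tensorRelations R Q N →
      z ∈ tensorRelations R Q M

/-- `f` is a pure monomorphism of left `R`-modules: it is injective and stays injective
after tensoring with every right `R`-module. -/
def IsPureMono (R : Type u) [Ring R] {M N : Type u} [AddCommGroup M] [Module R M]
    [AddCommGroup N] [Module R N] (f : M →ₗ[R] N) : Prop :=
  Function.Injective f ∧
    ∀ (Q : Type u) [AddCommGroup Q] [Module Rᵐᵒᵖ Q], StaysInjective R Q f

/-- `N` is a pure submodule of `M`. -/
def IsPureSubmodule (R : Type u) [Ring R] {M : Type u} [AddCommGroup M] [Module R M]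
    (N : Submodule R M) : Prop :=
  IsPureMono R N.subtype

/-- `0 → M' → M → M'' → 0` is a pure exact sequence of left `R`-modules. -/
def IsPureExactSeq (R : Type u) [Ring R] {M' M M'' : Type u}
    [AddCommGroup M'] [Module R M'] [AddCommGroup M] [Module R M]
    [AddCommGroup M''] [Module R M'']
    (f : M' →ₗ[R] M) (g : M →ₗ[R] M'') : Prop :=
  Function.Surjective g ∧ Function.Exact f g ∧ IsPureMono R f

/-- The kernel of the map `B ⊗_R M → B ⊗_R N` induced by `f`, where `B ⊗_R -` is realized
as the quotient of `B ⊗_ℤ -` by `tensorRelations`. -/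
def tensorKernel (R : Type u) [Ring R] (B : Type u) [AddCommGroup B]
    [Module Rᵐᵒᵖ B] (M N : Type u) [AddCommGroup M] [Module R M] [AddCommGroup N] [Module R N]
    (f : M →ₗ[R] N) : Type u :=
  let S : Submodule ℤ (TensorProduct ℤ B M) :=
    (tensorRelations R B N).comap (LinearMap.lTensor B f.toAddMonoidHom.toIntLinearMap)
  S ⧸ ((tensorRelations R B M).comap S.subtype)

instance tensorKernelAddCommGroup (R : Type u) [Ring R] (B : Type u) [AddCommGroup B]
    [Module Rᵐᵒᵖ B] (M N : Type u) [AddCommGroup M] [Module R M] [AddCommGroup N] [Module R N]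
    (f : M →ₗ[R] N) : AddCommGroup (tensorKernel R B M N f) :=
  inferInstanceAs (AddCommGroup (_ ⧸ _))

/-- `Tor₁^R(B, M)` for a right `R`-module `B` and a left `R`-module `M`, realized via the
canonical free presentation `0 → K → (M →₀ R) → M → 0` as the kernel of
`B ⊗_R K → B ⊗_R (M →₀ R)`. -/
def Tor1 (R : Type u) [Ring R] (B : Type u) [AddCommGroup B] [Module Rᵐᵒᵖ B]
    (M : Type u) [AddCommGroup M] [Module R M] : Type u :=
  tensorKernel R B (LinearMap.ker (Finsupp.linearCombination R (id : M → M))) (M →₀ R)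
    (LinearMap.ker (Finsupp.linearCombination R (id : M → M))).subtype

instance tor1AddCommGroup (R : Type u) [Ring R] (B : Type u) [AddCommGroup B] [Module Rᵐᵒᵖ B]
    (M : Type u) [AddCommGroup M] [Module R M] : AddCommGroup (Tor1 R B M) :=
  inferInstanceAs (AddCommGroup (tensorKernel R B _ _ _))

/-- The right `R`-module structure on the Pontryagin dual `Hom_ℤ(X, ℚ/ℤ)` of a left
`R`-module `X`, given by `(φ • r) x = φ (r • x)`. -/
instance pdualModule (R : Type u) [Ring R] (X : Type u) [AddCommGroup X] [Module R X] :
    Module Rᵐᵒᵖ (X →+ AddCircle (1 : ℚ)) :=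
  inferInstanceAs (Module Rᵈᵐᵃ (X →+ AddCircle (1 : ℚ)))

/-- The Pontryagin dual of an `R`-linear map of left `R`-modules, as a map of
right `R`-modules. -/
def pdualMap (R : Type u) [Ring R] {M N : Type u} [AddCommGroup M] [Module R M]
    [AddCommGroup N] [Module R N] (f : M →ₗ[R] N) :
    (N →+ AddCircle (1 : ℚ)) →ₗ[Rᵐᵒᵖ] (M →+ AddCircle (1 : ℚ)) where
  toFun φ := φ.comp f.toAddMonoidHom
  map_add' φ ψ := by ext x; rfl
  map_smul' r φ := by ext x; exact (congrArg φ (f.map_smul r.unop x)).symm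

/-- Divisibility of `ℚ/ℤ`: a character vanishing on the kernel of `T` extends along `T`. -/
theorem exists_character_comp_eq {M N : Type*} [AddCommGroup M] [AddCommGroup N]
    (T : M →+ N) (φ : M →+ AddCircle (1 : ℚ)) (h : ∀ m, T m = 0 → φ m = 0) :
    ∃ ψ : N →+ AddCircle (1 : ℚ), ∀ m, ψ (T m) = φ m := by
  obtain ⟨ψ, hψ⟩ := CharacterModule.dual_surjective_of_injective (R := ℤ)
    (QuotientAddGroup.kerLift T).toIntLinearMap (QuotientAddGroup.kerLift_injective T)
    (QuotientAddGroup.lift T.ker φ h)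
  exact ⟨ψ, fun m ↦ DFunLike.congr_fun hψ (QuotientAddGroup.mk m)⟩

/-- The Pontryagin dual of a free left module is an injective right module: a map vanishing on
the kernel of `T` extends along `T`. -/
theorem exists_comp_eq_of_pdual_finsupp {R : Type u} [Ring R] {ι : Type u} {M N : Type*}
    [AddCommGroup M] [Module Rᵐᵒᵖ M] [AddCommGroup N] [Module Rᵐᵒᵖ N] (T : M →ₗ[Rᵐᵒᵖ] N)
    (φ : M →ₗ[Rᵐᵒᵖ] ((ι →₀ R) →+ AddCircle (1 : ℚ))) (h : ∀ m, T m = 0 → φ m = 0) :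
    ∃ ψ : N →ₗ[Rᵐᵒᵖ] ((ι →₀ R) →+ AddCircle (1 : ℚ)), ψ ∘ₗ T = φ := by
  have key (x : ι) := exists_character_comp_eq T.toAddMonoidHom
    ((AddMonoidHom.eval (Finsupp.single x (1 : R))).comp φ.toAddMonoidHom)
    (fun m hm ↦ by
      have := h m hm
      simp [this])
  choose c hc using key
  let ψ : N →ₗ[Rᵐᵒᵖ] ((ι →₀ R) →+ AddCircle (1 : ℚ)) :=
    { toFun := fun n ↦ Finsupp.liftAddHom fun x ↦
        { toFun := fun r ↦ c x (MulOpposite.op r • n)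
          map_zero' := by simp
          map_add' := fun r s ↦ by simp [add_smul] }
      map_add' := fun m n ↦ by
        ext x r
        simp
      map_smul' := fun s n ↦ by
        ext x r
        change _ = Finsupp.liftAddHom _ (s.unop • Finsupp.single x r)
        simp [-Finsupp.single_mul, mul_smul] }
  refine ⟨ψ, LinearMap.ext fun m ↦ ?_⟩
  ext x r
  have h1 : ψ (T m) (Finsupp.single x r) = c x (MulOpposite.op r • T m) := by simp [ψ]
  have h2 : φ (MulOpposite.op r • m) (Finsupp.single x 1) = φ m (r • Finsupp.single x 1) := by
    rw [map_smul]; rfl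
  have h3 := hc x (MulOpposite.op r • m)
  simp only [LinearMap.toAddMonoidHom_coe, AddMonoidHom.comp_apply, map_smul,
    AddMonoidHom.eval_apply_apply] at h3
  simp only [map_smul] at h2
  simpa [h1, h3] using h2

/-- A relation between two groups that is total on both sides and matches the kernels of two
surjections induces an isomorphism of their targets. -/
theorem nonempty_addEquiv_of_relation {Z W H₁ H₂ : Type*} [AddCommGroup Z] [AddCommGroup W]
    [AddCommGroup H₁] [AddCommGroup H₂] (Γ : AddSubgroup (Z × W)) (p : Z →+ H₁) (q : W →+ H₂)
    (hp : Function.Surjective p) (hq : Function.Surjective q)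
    (hZ : ∀ z, ∃ w, (z, w) ∈ Γ) (hW : ∀ w, ∃ z, (z, w) ∈ Γ)
    (hpq : ∀ z w, (z, w) ∈ Γ → (p z = 0 ↔ q w = 0)) : Nonempty (H₁ ≃+ H₂) := by
  let p' : Γ →+ H₁ := (p.comp (AddMonoidHom.fst Z W)).comp Γ.subtype
  let q' : Γ →+ H₂ := (q.comp (AddMonoidHom.snd Z W)).comp Γ.subtype
  have hp' : Function.Surjective p' := fun y ↦ by
    obtain ⟨z, rfl⟩ := hp y
    obtain ⟨w, hw⟩ := hZ z
    exact ⟨⟨(z, w), hw⟩, rfl⟩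
  have hq' : Function.Surjective q' := fun y ↦ by
    obtain ⟨w, rfl⟩ := hq y
    obtain ⟨z, hz⟩ := hW w
    exact ⟨⟨(z, w), hz⟩, rfl⟩
  have hker : p'.ker = q'.ker := by
    ext ⟨⟨z, w⟩, h⟩
    exact hpq z w h
  exact ⟨((QuotientAddGroup.quotientKerEquivOfSurjective p' hp').symm.trans
    (QuotientAddGroup.quotientAddEquivOfEq hker)).trans
    (QuotientAddGroup.quotientKerEquivOfSurjective q' hq')⟩

section Pairing

variable {R : Type u} [Ring R] {B : Type u} [AddCommGroup B] [Module Rᵐᵒᵖ B]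
  {M N : Type u} [AddCommGroup M] [Module R M] [AddCommGroup N] [Module R N]

/-- The character of `B ⊗_ℤ M` attached to a map from `B` to the Pontryagin dual of `M`. -/
def tensorCharacter :
    (B →ₗ[Rᵐᵒᵖ] (M →+ AddCircle (1 : ℚ))) →+ (TensorProduct ℤ B M →+ AddCircle (1 : ℚ)) where
  toFun φ := TensorProduct.liftAddHom φ.toAddMonoidHom fun r a b ↦ by simp
  map_zero' := by
    ext z
    induction z using TensorProduct.induction_on <;> simp_all
  map_add' φ ψ := by
    ext z
    induction z using TensorProduct.induction_on with
    | zero => simp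
    | tmul b m => rfl
    | add x y hx hy =>
      simp only [map_add, AddMonoidHom.add_apply] at hx hy ⊢
      rw [hx, hy, add_add_add_comm]

@[simp]
theorem tensorCharacter_tmul (φ : B →ₗ[Rᵐᵒᵖ] (M →+ AddCircle (1 : ℚ))) (b : B) (m : M) :
    tensorCharacter φ (b ⊗ₜ[ℤ] m) = φ b m := rfl

theorem tensorCharacter_eq_zero_of_mem (φ : B →ₗ[Rᵐᵒᵖ] (M →+ AddCircle (1 : ℚ)))
    {z : TensorProduct ℤ B M} (hz : z ∈ tensorRelations R B M) : tensorCharacter φ z = 0 := by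
  have : tensorRelations R B M ≤ LinearMap.ker (tensorCharacter φ).toIntLinearMap := by
    refine Submodule.span_le.2 ?_
    rintro _ ⟨q, r, m, rfl⟩
    have : φ (MulOpposite.op r • q) m = φ q (r • m) := by rw [map_smul]; rfl
    simp only [SetLike.mem_coe, LinearMap.mem_ker, AddMonoidHom.coe_toIntLinearMap, map_sub,
      tensorCharacter_tmul, this, sub_self]
  exact this hz

theorem exists_tensorCharacter_eq (c : TensorProduct ℤ B M →+ AddCircle (1 : ℚ))
    (hc : ∀ z ∈ tensorRelations R B M, c z = 0) :
    ∃ φ : B →ₗ[Rᵐᵒᵖ] (M →+ AddCircle (1 : ℚ)), tensorCharacter φ = c := by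
  refine ⟨
    { toFun := fun b ↦ c.comp (TensorProduct.mk ℤ B M b).toAddMonoidHom
      map_add' := fun a b ↦ by
        ext m
        simp
      map_smul' := fun r b ↦ by
        ext m
        have := hc _ (Submodule.subset_span ⟨b, r.unop, m, rfl⟩)
        rw [map_sub, sub_eq_zero] at this
        exact this }, ?_⟩
  ext z
  induction z using TensorProduct.induction_on with
  | zero => simp
  | tmul b m => rfl
  | add x y hx hy => simp [hx, hy]

theorem tensorCharacter_pdualMap_comp (f : M →ₗ[R] N)
    (ψ : B →ₗ[Rᵐᵒᵖ] (N →+ AddCircle (1 : ℚ))) (z : TensorProduct ℤ B M) :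
    tensorCharacter (pdualMap R f ∘ₗ ψ) z =
      tensorCharacter ψ (LinearMap.lTensor B f.toAddMonoidHom.toIntLinearMap z) := by
  induction z using TensorProduct.induction_on with
  | zero => simp
  | tmul b m => rfl
  | add x y hx hy => simp [hx, hy]

theorem lTensor_mem_tensorRelations (f : M →ₗ[R] N) {z : TensorProduct ℤ B M}
    (hz : z ∈ tensorRelations R B M) :
    LinearMap.lTensor B f.toAddMonoidHom.toIntLinearMap z ∈ tensorRelations R B N := by
  have : tensorRelations R B M ≤
      (tensorRelations R B N).comap (LinearMap.lTensor B f.toAddMonoidHom.toIntLinearMap) := by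
    refine Submodule.span_le.2 ?_
    rintro _ ⟨q, r, m, rfl⟩
    exact Submodule.subset_span ⟨q, r, f m, by simp⟩
  exact this hz

variable (B) in
/-- The restriction to `ker (B ⊗_R M → B ⊗_R N)` of the characters of `B ⊗_R M`. -/
def tensorKernelCharacter (f : M →ₗ[R] N) :
    (B →ₗ[Rᵐᵒᵖ] (M →+ AddCircle (1 : ℚ))) →+
      (tensorKernel R B M N f →+ AddCircle (1 : ℚ)) where
  toFun φ := QuotientAddGroup.lift _
    ((tensorCharacter φ).comp (Submodule.subtype _).toAddMonoidHom)
    fun _ hz ↦ tensorCharacter_eq_zero_of_mem φ hz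
  map_zero' := by
    ext z
    obtain ⟨z, rfl⟩ := Submodule.Quotient.mk_surjective _ z
    exact DFunLike.congr_fun (map_zero tensorCharacter) z.1
  map_add' φ ψ := by
    ext z
    obtain ⟨z, rfl⟩ := Submodule.Quotient.mk_surjective _ z
    exact DFunLike.congr_fun (map_add tensorCharacter φ ψ) z.1

theorem tensorKernelCharacter_surjective (f : M →ₗ[R] N) :
    Function.Surjective (tensorKernelCharacter B f) := by
  intro c
  let S := (tensorRelations R B N).comap (LinearMap.lTensor B f.toAddMonoidHom.toIntLinearMap)
  let π : S →+ tensorKernel R B M N f :=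
    (Submodule.mkQ ((tensorRelations R B M).comap S.subtype)).toAddMonoidHom
  obtain ⟨d, hd⟩ := exists_character_comp_eq S.subtype.toAddMonoidHom (c.comp π) (by
    intro z hz
    rw [show z = 0 from Subtype.ext hz, map_zero])
  obtain ⟨φ, rfl⟩ := exists_tensorCharacter_eq (R := R) d fun z hz ↦ by
    have h := hd ⟨z, lTensor_mem_tensorRelations f hz⟩
    have h0 : π ⟨z, lTensor_mem_tensorRelations f hz⟩ = 0 :=
      (Submodule.Quotient.mk_eq_zero _).2 hz
    rw [AddMonoidHom.comp_apply, h0, map_zero] at h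
    exact h
  refine ⟨φ, ?_⟩
  ext z
  obtain ⟨z, rfl⟩ := Submodule.Quotient.mk_surjective _ z
  exact hd z

theorem tensorKernelCharacter_eq_zero_iff (f : M →ₗ[R] N)
    (φ : B →ₗ[Rᵐᵒᵖ] (M →+ AddCircle (1 : ℚ))) :
    tensorKernelCharacter B f φ = 0 ↔ ∃ ψ, pdualMap R f ∘ₗ ψ = φ := by
  constructor
  · intro h
    obtain ⟨c, hc⟩ := exists_character_comp_eq
      ((tensorRelations R B N).mkQ ∘ₗ
        LinearMap.lTensor B f.toAddMonoidHom.toIntLinearMap).toAddMonoidHom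
      (tensorCharacter φ) (fun z hz ↦ by
        have hz' : LinearMap.lTensor B f.toAddMonoidHom.toIntLinearMap z ∈
          tensorRelations R B N := (Submodule.Quotient.mk_eq_zero _).1 hz
        let S := (tensorRelations R B N).comap
          (LinearMap.lTensor B f.toAddMonoidHom.toIntLinearMap)
        exact DFunLike.congr_fun h
          (Submodule.Quotient.mk (p := (tensorRelations R B M).comap S.subtype) ⟨z, hz'⟩))
    obtain ⟨ψ, hψ⟩ := exists_tensorCharacter_eq (R := R)
      (c.comp (tensorRelations R B N).mkQ.toAddMonoidHom) (fun z hz ↦ by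
        have : (tensorRelations R B N).mkQ z = 0 := (Submodule.Quotient.mk_eq_zero _).2 hz
        simp [this])
    refine ⟨ψ, ?_⟩
    ext b m
    rw [← tensorCharacter_tmul, ← tensorCharacter_tmul, tensorCharacter_pdualMap_comp, hψ]
    exact hc _
  · rintro ⟨ψ, rfl⟩
    ext z
    obtain ⟨z, rfl⟩ := Submodule.Quotient.mk_surjective _ z
    exact (tensorCharacter_pdualMap_comp f ψ z.1).trans (tensorCharacter_eq_zero_of_mem ψ z.2)

end Pairing

/-- A linear map vanishing on the kernel of a surjection descends along it. -/
theorem exists_comp_eq_of_surjective {S : Type*} [Ring S] {M N L : Type*} [AddCommGroup M]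
    [Module S M] [AddCommGroup N] [Module S N] [AddCommGroup L] [Module S L] (ε : M →ₗ[S] N)
    (hε : Function.Surjective ε) (g : M →ₗ[S] L) (h : ∀ m, ε m = 0 → g m = 0) :
    ∃ k : N →ₗ[S] L, k ∘ₗ ε = g := by
  refine ⟨(LinearMap.ker ε).liftQ g h ∘ₗ (ε.quotKerEquivOfSurjective hε).symm, ?_⟩
  ext m
  have : (ε.quotKerEquivOfSurjective hε).symm (ε m) = Submodule.Quotient.mk m := by
    rw [LinearEquiv.symm_apply_eq]
    rfl
  simp only [LinearMap.comp_apply, LinearEquiv.coe_coe, this]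
  exact Submodule.liftQ_apply ..

/-- A linear map landing in the kernel of `π` lifts along an injection with image that kernel. -/
theorem exists_comp_eq_of_exact {S : Type*} [Ring S] {M A I C : Type*} [AddCommGroup M]
    [Module S M] [AddCommGroup A] [Module S A] [AddCommGroup I] [Module S I] [AddCommGroup C]
    [Module S C] (i : A →ₗ[S] I) (hi : Function.Injective i) (π : I →ₗ[S] C)
    (hex : Function.Exact i π) (g : M →ₗ[S] I) (h : ∀ m, π (g m) = 0) :
    ∃ k : M →ₗ[S] A, i ∘ₗ k = g := by
  have hr (m : M) : g m ∈ LinearMap.range i := (hex _).1 (h m)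
  refine ⟨(LinearEquiv.ofInjective i hi).symm ∘ₗ g.codRestrict _ hr, ?_⟩
  ext m
  exact congrArg Subtype.val
    ((LinearEquiv.ofInjective i hi).apply_symm_apply (g.codRestrict _ hr m))

theorem pdualMap_injective {R : Type u} [Ring R] {M N : Type u} [AddCommGroup M] [Module R M]
    [AddCommGroup N] [Module R N] (f : M →ₗ[R] N) (hf : Function.Surjective f) :
    Function.Injective (pdualMap R f) := by
  intro φ ψ h
  ext n
  obtain ⟨m, rfl⟩ := hf n
  exact DFunLike.congr_fun h m

theorem pdualMap_surjective {R : Type u} [Ring R] {M N : Type u} [AddCommGroup M] [Module R M]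
    [AddCommGroup N] [Module R N] (f : M →ₗ[R] N) (hf : Function.Injective f) :
    Function.Surjective (pdualMap R f) := by
  intro φ
  obtain ⟨ψ, hψ⟩ := exists_character_comp_eq f.toAddMonoidHom φ fun m hm ↦ by
    rw [hf (hm.trans (map_zero f).symm), map_zero]
  exact ⟨ψ, AddMonoidHom.ext hψ⟩

theorem pdualMap_exact {R : Type u} [Ring R] {L M N : Type u} [AddCommGroup L] [Module R L]
    [AddCommGroup M] [Module R M] [AddCommGroup N] [Module R N] (f : L →ₗ[R] M) (g : M →ₗ[R] N)
    (h : Function.Exact f g) : Function.Exact (pdualMap R g) (pdualMap R f) := by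
  intro φ
  constructor
  · intro hφ
    obtain ⟨ψ, hψ⟩ := exists_character_comp_eq g.toAddMonoidHom φ fun m hm ↦ by
      obtain ⟨l, rfl⟩ := (h m).1 hm
      exact DFunLike.congr_fun hφ l
    exact ⟨ψ, AddMonoidHom.ext hψ⟩
  · rintro ⟨ψ, rfl⟩
    ext l
    change ψ (g (f l)) = 0
    rw [h.apply_apply_eq_zero, map_zero]

/-- Dimension shifting: for a projective resolution of `B` and an exact sequence
`0 → A → I → C → 0` whose middle term has the extension property, the first cohomology of
`Hom(P, A)` is the cokernel of `Hom(B, I) → Hom(B, C)`. Here `Z` is the group of cocycles, and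
`H₁` and `H₂` are the two quotients. -/
theorem nonempty_addEquiv_of_dimension_shift {S : Type u} [Ring S] {P₂ P₁ P₀ B A I C : Type u}
    [AddCommGroup P₂] [Module S P₂] [AddCommGroup P₁] [Module S P₁] [AddCommGroup P₀]
    [Module S P₀] [AddCommGroup B] [Module S B] [AddCommGroup A] [Module S A] [AddCommGroup I]
    [Module S I] [AddCommGroup C] [Module S C] [Module.Projective S P₀]
    (d₂ : P₂ →ₗ[S] P₁) (d₁ : P₁ →ₗ[S] P₀) (ε : P₀ →ₗ[S] B)
    (hd : Function.Exact d₂ d₁) (hdε : Function.Exact d₁ ε) (hε : Function.Surjective ε)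
    (i : A →ₗ[S] I) (π : I →ₗ[S] C) (hi : Function.Injective i) (hex : Function.Exact i π)
    (hπ : Function.Surjective π)
    (hI : ∀ φ : P₁ →ₗ[S] I, (∀ m, d₁ m = 0 → φ m = 0) → ∃ ψ : P₀ →ₗ[S] I, ψ ∘ₗ d₁ = φ)
    {Z H₁ H₂ : Type*} [AddCommGroup Z] [AddCommGroup H₁] [AddCommGroup H₂]
    (j : Z →+ (P₁ →ₗ[S] A)) (hj : ∀ f, f ∘ₗ d₂ = 0 ↔ ∃ z, j z = f)
    (p : Z →+ H₁) (hp : Function.Surjective p) (hpz : ∀ z, p z = 0 ↔ ∃ k, k ∘ₗ d₁ = j z)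
    (q : (B →ₗ[S] C) →+ H₂) (hq : Function.Surjective q)
    (hqφ : ∀ φ, q φ = 0 ↔ ∃ h, π ∘ₗ h = φ) :
    Nonempty (H₁ ≃+ H₂) := by
  let Γ : AddSubgroup (Z × (B →ₗ[S] C)) :=
    { carrier := {x | ∃ g : P₀ →ₗ[S] I, g ∘ₗ d₁ = i ∘ₗ j x.1 ∧ π ∘ₗ g = x.2 ∘ₗ ε}
      zero_mem' := ⟨0, by simp, by simp⟩
      add_mem' := by
        rintro x y ⟨g, hg₁, hg₂⟩ ⟨g', hg₁', hg₂'⟩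
        refine ⟨g + g', ?_, ?_⟩
        · simp [LinearMap.add_comp, LinearMap.comp_add, hg₁, hg₁']
        · simp [LinearMap.add_comp, LinearMap.comp_add, hg₂, hg₂']
      neg_mem' := by
        rintro x ⟨g, hg₁, hg₂⟩
        refine ⟨-g, ?_, ?_⟩
        · simp [LinearMap.neg_comp, LinearMap.comp_neg, hg₁]
        · simp [LinearMap.neg_comp, LinearMap.comp_neg, hg₂] }
  refine nonempty_addEquiv_of_relation Γ p q hp hq (fun z ↦ ?_) (fun φ ↦ ?_) ?_
  · have hz : j z ∘ₗ d₂ = 0 := (hj _).2 ⟨z, rfl⟩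
    obtain ⟨g, hg⟩ := hI (i ∘ₗ j z) fun m hm ↦ by
      obtain ⟨l, rfl⟩ := (hd m).1 hm
      have := LinearMap.congr_fun hz l
      simp_all
    obtain ⟨φ, hφ⟩ := exists_comp_eq_of_surjective ε hε (π ∘ₗ g) fun m hm ↦ by
      obtain ⟨l, rfl⟩ := (hdε m).1 hm
      have := LinearMap.congr_fun hg l
      simp only [LinearMap.comp_apply] at this ⊢
      rw [this, hex.apply_apply_eq_zero]
    exact ⟨φ, g, hg, hφ.symm⟩
  · obtain ⟨g, hg⟩ := Module.projective_lifting_property π (φ ∘ₗ ε) hπ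
    obtain ⟨f, hf⟩ := exists_comp_eq_of_exact i hi π hex (g ∘ₗ d₁) fun m ↦ by
      have := LinearMap.congr_fun hg (d₁ m)
      simp only [LinearMap.comp_apply] at this ⊢
      rw [this, hdε.apply_apply_eq_zero, map_zero]
    obtain ⟨z, rfl⟩ := (hj f).1 <| LinearMap.ext fun m ↦ hi <| by
      have := LinearMap.congr_fun hf (d₂ m)
      simp only [LinearMap.comp_apply] at this ⊢
      rw [this, hd.apply_apply_eq_zero, map_zero, LinearMap.zero_apply, map_zero]
    exact ⟨z, g, hf.symm, hg⟩
  · rintro z φ ⟨g, hg₁, hg₂⟩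
    rw [hpz, hqφ]
    constructor
    · rintro ⟨k, hk⟩
      obtain ⟨h, hh⟩ := exists_comp_eq_of_surjective ε hε (g - i ∘ₗ k) fun m hm ↦ by
        obtain ⟨l, rfl⟩ := (hdε m).1 hm
        have h₁ := LinearMap.congr_fun hg₁ l
        have h₂ := LinearMap.congr_fun hk l
        simp only [LinearMap.comp_apply, LinearMap.sub_apply] at h₁ h₂ ⊢
        rw [h₁, h₂, sub_self]
      refine ⟨h, LinearMap.ext fun b ↦ ?_⟩
      obtain ⟨m, rfl⟩ := hε b
      have h₁ := LinearMap.congr_fun hh m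
      have h₂ := LinearMap.congr_fun hg₂ m
      simp only [LinearMap.comp_apply, LinearMap.sub_apply] at h₁ h₂ ⊢
      rw [h₁, map_sub, hex.apply_apply_eq_zero, sub_zero, h₂]
    · rintro ⟨h, rfl⟩
      obtain ⟨k, hk⟩ := exists_comp_eq_of_exact i hi π hex (g - h ∘ₗ ε) fun m ↦ by
        have := LinearMap.congr_fun hg₂ m
        simp only [LinearMap.comp_apply, LinearMap.sub_apply, map_sub] at this ⊢
        rw [this, sub_self]
      refine ⟨k, LinearMap.ext fun m ↦ hi ?_⟩
      have h₁ := LinearMap.congr_fun hk (d₁ m)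
      have h₂ := LinearMap.congr_fun hg₁ m
      simp only [LinearMap.comp_apply, LinearMap.sub_apply] at h₁ h₂ ⊢
      rw [h₁, hdε.apply_apply_eq_zero, map_zero, sub_zero, h₂]

/-- The class map from cocycles to the homology of a short complex of modules. -/
theorem exists_homology_class_map {S : Type*} [Ring S] (K : ShortComplex (ModuleCat S)) :
    ∃ p : LinearMap.ker K.g.hom →+ K.homology, Function.Surjective p ∧
      ∀ z, p z = 0 ↔ ∃ x, K.f.hom x = z.1 := by
  let e := K.moduleCatHomologyIso.symm.toLinearEquiv
  let π := (LinearMap.range K.moduleCatToCycles).mkQ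
  refine ⟨(e.toLinearMap ∘ₗ π).toAddMonoidHom,
    e.surjective.comp (Submodule.mkQ_surjective _), fun z ↦ ?_⟩
  change e (π z) = 0 ↔ _
  refine (e.map_eq_zero_iff.trans (Submodule.Quotient.mk_eq_zero _)).trans ?_
  exact ⟨fun ⟨x, hx⟩ ↦ ⟨x, congrArg Subtype.val hx⟩, fun ⟨x, hx⟩ ↦ ⟨x, Subtype.ext hx⟩⟩

/-- `Ext¹(B, A)` is the cokernel of `Hom(B, I) → Hom(B, C)` for an exact sequence
`0 → A → I → C → 0` in which `I` has the extension property of injective modules. -/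
theorem nonempty_ext_one_addEquiv {S : Type u} [Ring S] {B A I C : Type u}
    [AddCommGroup B] [Module S B] [AddCommGroup A] [Module S A] [AddCommGroup I]
    [Module S I] [AddCommGroup C] [Module S C]
    (i : A →ₗ[S] I) (π : I →ₗ[S] C) (hi : Function.Injective i) (hex : Function.Exact i π)
    (hπ : Function.Surjective π)
    (hI : ∀ (M N : Type u) [AddCommGroup M] [AddCommGroup N] [Module S M] [Module S N]
      (T : M →ₗ[S] N) (φ : M →ₗ[S] I), (∀ m, T m = 0 → φ m = 0) → ∃ ψ : N →ₗ[S] I, ψ ∘ₗ T = φ)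
    {H : Type*} [AddCommGroup H] (q : (B →ₗ[S] C) →+ H) (hq : Function.Surjective q)
    (hqφ : ∀ φ, q φ = 0 ↔ ∃ h, π ∘ₗ h = φ) :
    Nonempty ((((Ext ℤ (ModuleCat.{u} S) 1).obj (Opposite.op (ModuleCat.of S B))).obj
      (ModuleCat.of S A)) ≃+ H) := by
  let P := projectiveResolution (ModuleCat.of S B)
  let Y := ModuleCat.of S A
  let K := P.complex.linearYonedaObj ℤ Y
  let E := (P.isoExt (R := ℤ) 1 Y ≪≫ K.homologyIsoSc' 0 1 2 (by simp) (by simp)).toLinearEquiv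
  obtain ⟨p, hp, hpz⟩ := exists_homology_class_map (K.sc' 0 1 2)
  have hproj : Module.Projective S (P.complex.X 0) :=
    (IsProjective.iff_projective _).2 (P.projective 0)
  let j : LinearMap.ker (K.sc' 0 1 2).g.hom →+ (P.complex.X 1 →ₗ[S] A) :=
    (ModuleCat.homAddEquiv (M := P.complex.X 1) (N := Y)).toAddMonoidHom.comp
      (LinearMap.ker (K.sc' 0 1 2).g.hom).subtype.toAddMonoidHom
  let ε : P.complex.X 0 →ₗ[S] B := (P.π.f 0).hom
  obtain ⟨e⟩ := nonempty_addEquiv_of_dimension_shift (P.complex.d 2 1).hom (P.complex.d 1 0).hom ε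
    ((ShortComplex.ShortExact.moduleCat_exact_iff_function_exact _).1 (P.exact_succ 0))
    ((ShortComplex.ShortExact.moduleCat_exact_iff_function_exact _).1 P.exact₀)
    ((ModuleCat.epi_iff_surjective _).1 inferInstance)
    i π hi hex hπ (hI _ _ _) j
    (fun f ↦ ⟨fun hf ↦ ⟨⟨ModuleCat.ofHom f, ModuleCat.hom_ext hf⟩, rfl⟩, by
      rintro ⟨z, rfl⟩
      exact congrArg ModuleCat.Hom.hom z.2⟩)
    p hp
    (fun z ↦ (hpz z).trans ⟨fun ⟨k, hk⟩ ↦ ⟨ModuleCat.Hom.hom k, congrArg ModuleCat.Hom.hom hk⟩,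
      fun ⟨k, hk⟩ ↦ ⟨ModuleCat.ofHom k, ModuleCat.hom_ext hk⟩⟩)
    q hq hqφ
  exact ⟨E.toAddEquiv.trans e⟩

/-- `Ext¹(B, X^∨)` is the Pontryagin dual of `ker (B ⊗_R L → B ⊗_R F)` for any exact sequence
`0 → L → F → X → 0` with `F` free. -/
theorem nonempty_ext_one_pdual_addEquiv {R : Type u} [Ring R] (B : Type u) [AddCommGroup B]
    [Module Rᵐᵒᵖ B] {L ι X : Type u} [AddCommGroup L] [Module R L] [AddCommGroup X] [Module R X]
    (κ : L →ₗ[R] (ι →₀ R)) (σ : (ι →₀ R) →ₗ[R] X) (hκ : Function.Injective κ)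
    (hκσ : Function.Exact κ σ) (hσ : Function.Surjective σ) :
    Nonempty ((((Ext ℤ (ModuleCat.{u} Rᵐᵒᵖ) 1).obj (Opposite.op (ModuleCat.of Rᵐᵒᵖ B))).obj
      (ModuleCat.of Rᵐᵒᵖ (X →+ AddCircle (1 : ℚ)))) ≃+
        (tensorKernel R B L (ι →₀ R) κ →+ AddCircle (1 : ℚ))) :=
  nonempty_ext_one_addEquiv (pdualMap R σ) (pdualMap R κ) (pdualMap_injective σ hσ)
    (pdualMap_exact κ σ hκσ) (pdualMap_surjective κ hκ)
    (fun _ _ _ _ _ _ T φ h ↦ exists_comp_eq_of_pdual_finsupp T φ h)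
    (tensorKernelCharacter B κ) (tensorKernelCharacter_surjective κ)
    (tensorKernelCharacter_eq_zero_iff κ)

/-- For a right `R`-module `B` and a left `R`-module `X`, there is an isomorphism
`Ext¹_{Rᵒᵖ}(B, Hom_ℤ(X, ℚ/ℤ)) ≅ Hom_ℤ(Tor₁^R(B, X), ℚ/ℤ)`. -/
theorem stmt7 (R : Type u) [Ring R] (B : Type u) [AddCommGroup B] [Module Rᵐᵒᵖ B]
    (X : Type u) [AddCommGroup X] [Module R X] :
    Nonempty
      ((((Ext ℤ (ModuleCat.{u} Rᵐᵒᵖ) 1).obj (Opposite.op (ModuleCat.of Rᵐᵒᵖ B))).obj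
          (ModuleCat.of Rᵐᵒᵖ (X →+ AddCircle (1 : ℚ)))) ≃+
        (Tor1 R B X →+ AddCircle (1 : ℚ))) := by
  exact nonempty_ext_one_pdual_addEquiv B _ (Finsupp.linearCombination R (id : X → X))
    Subtype.val_injective (LinearMap.exact_subtype_ker_map _)
    (Finsupp.linearCombination_id_surjective R X)

end
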